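/- Suppose α, β > 0, α(‖P‖ + β‖H‖²) < 1, and ρ ∈ (0, 2), and let (z^j, w^j, ξ^j, η^j) be the xPIPG iterates from arbitrary initial points ξ¹ ∈ ℝ^n, η¹ ∈ ℝ^m, with limits z̄ := lim_{j→∞} (z^{j+1} − z^j) and w̄ := lim_{j→∞} (w^{j+1} − w^j) (which exist). Then ⟨z̄, P z̄ + Hᵀ w̄⟩ = 0, ⟨w̄, H z̄⟩ = 0, and consequently P z̄ = 0. -/

import Mathlib

open scoped RealInnerProductSpace
open Filter Topology Matrix

/-- Spectral norm (largest singular value) of a real matrix. -/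
noncomputable def specNorm {ι κ : Type*} [Fintype ι] [Fintype κ] [DecidableEq κ]
    (A : Matrix ι κ ℝ) : ℝ :=
  ‖LinearMap.toContinuousLinearMap (Matrix.toEuclideanLin A)‖

/-- The linear map on Euclidean space induced by a matrix (matrix-vector product). -/
noncomputable def mvec {ι κ : Type*} [Fintype ι] [Fintype κ] [DecidableEq κ]
    (A : Matrix ι κ ℝ) (x : EuclideanSpace ℝ κ) : EuclideanSpace ℝ ι :=
  Matrix.toEuclideanLin A x

open Classical in
/-- Projection onto a (nonempty closed convex) set: the minimizer of the distance to `x`. -/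
noncomputable def proj {ι : Type*} [Fintype ι] (C : Set (EuclideanSpace ℝ ι))
    (x : EuclideanSpace ℝ ι) : EuclideanSpace ℝ ι :=
  if h : ∃ y ∈ C, ∀ c ∈ C, ‖x - y‖ ≤ ‖x - c‖ then h.choose else x

/-- Polar cone `K° = {w | ⟨w, y⟩ ≤ 0 for all y ∈ K}`. -/
def polarCone {ι : Type*} [Fintype ι] (K : Set (EuclideanSpace ℝ ι)) :
    Set (EuclideanSpace ℝ ι) := {w | ∀ y ∈ K, ⟪w, y⟫ ≤ 0}

/-- Recession cone `rec D = {y | y + z ∈ D for all z ∈ D}`. -/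
def recCone {ι : Type*} [Fintype ι] (D : Set (EuclideanSpace ℝ ι)) :
    Set (EuclideanSpace ℝ ι) := {y | ∀ z ∈ D, y + z ∈ D}

/-- Normal cone of `C` at `x`: `N_C(x) = {y | ⟨y, x' − x⟩ ≤ 0 for all x' ∈ C}`. -/
def normalCone {ι : Type*} [Fintype ι] (C : Set (EuclideanSpace ℝ ι))
    (x : EuclideanSpace ℝ ι) : Set (EuclideanSpace ℝ ι) :=
  {y | ∀ x' ∈ C, ⟪y, x' - x⟫ ≤ 0}

/-- A closed convex cone. -/
def IsClosedConvexCone {ι : Type*} [Fintype ι] (K : Set (EuclideanSpace ℝ ι)) : Prop :=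
  IsClosed K ∧ Convex ℝ K ∧ ∀ w ∈ K, ∀ c : ℝ, 0 ≤ c → c • w ∈ K

/-- Support function of `D`, valued in `EReal`: `σ_D(x) = sup_{y ∈ D} ⟨y, x⟩`. -/
noncomputable def supportF {ι : Type*} [Fintype ι] (D : Set (EuclideanSpace ℝ ι))
    (x : EuclideanSpace ℝ ι) : EReal :=
  ⨆ y : D, ((⟪(y : EuclideanSpace ℝ ι), x⟫ : ℝ) : EReal)

section Projection

variable {ι : Type*} [Fintype ι]

theorem proj_mem_and_inner_le_zero {C : Set (EuclideanSpace ℝ ι)} (hne : C.Nonempty)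
    (hcl : IsClosed C) (hcv : Convex ℝ C) (x : EuclideanSpace ℝ ι) :
    proj C x ∈ C ∧ ∀ c ∈ C, ⟪x - proj C x, c - proj C x⟫ ≤ 0 := by
  have hbdd : BddBelow (Set.range fun c : C => ‖x - c‖) :=
    ⟨0, by rintro _ ⟨c, rfl⟩; exact norm_nonneg _⟩
  have hex : ∃ y ∈ C, ∀ c ∈ C, ‖x - y‖ ≤ ‖x - c‖ := by
    obtain ⟨y, hy, hmin⟩ := exists_norm_eq_iInf_of_complete_convex hne hcl.isComplete hcv x
    exact ⟨y, hy, fun c hc => hmin.trans_le (ciInf_le hbdd ⟨c, hc⟩)⟩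
  have hproj : proj C x = hex.choose := by
    unfold proj
    rw [dif_pos hex]
  obtain ⟨hmem, hmin⟩ := hex.choose_spec
  rw [← hproj] at hmem hmin
  refine ⟨hmem, (norm_eq_iInf_iff_real_inner_le_zero hcv hmem).1 ?_⟩
  have : Nonempty C := hne.to_subtype
  exact le_antisymm (le_ciInf fun c => hmin c c.2) (ciInf_le hbdd ⟨_, hmem⟩)

theorem zero_mem_polarCone (K : Set (EuclideanSpace ℝ ι)) : 0 ∈ polarCone K := by
  intro y _
  simp

theorem smul_mem_polarCone {K : Set (EuclideanSpace ℝ ι)} {w : EuclideanSpace ℝ ι}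
    (hw : w ∈ polarCone K) {c : ℝ} (hc : 0 ≤ c) : c • w ∈ polarCone K := by
  intro y hy
  rw [real_inner_smul_left]
  exact mul_nonpos_of_nonneg_of_nonpos hc (hw y hy)

theorem isClosed_polarCone (K : Set (EuclideanSpace ℝ ι)) : IsClosed (polarCone K) := by
  simp only [polarCone, Set.ofPred_forall]
  exact isClosed_biInter fun y _ => isClosed_le (by fun_prop) continuous_const

theorem convex_polarCone (K : Set (EuclideanSpace ℝ ι)) : Convex ℝ (polarCone K) := by
  intro u hu v hv a b ha hb _ y hy
  rw [inner_add_left]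
  exact add_nonpos (smul_mem_polarCone hu ha y hy) (smul_mem_polarCone hv hb y hy)

theorem inner_sub_proj_polarCone (K : Set (EuclideanSpace ℝ ι)) (x : EuclideanSpace ℝ ι) :
    ⟪x - proj (polarCone K) x, proj (polarCone K) x⟫ = 0 := by
  obtain ⟨hmem, hle⟩ := proj_mem_and_inner_le_zero ⟨0, zero_mem_polarCone K⟩
    (isClosed_polarCone K) (convex_polarCone K) x
  have h0 := hle 0 (zero_mem_polarCone K)
  have h2 := hle _ (smul_mem_polarCone hmem (zero_le_two : (0 : ℝ) ≤ 2))
  rw [zero_sub, inner_neg_right] at h0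
  rw [two_smul, add_sub_cancel_right] at h2
  linarith

end Projection

section Growth

variable {E : Type*} [NormedAddCommGroup E] [NormedSpace ℝ E]

theorem tendsto_inv_natCast_smul_of_tendsto_sub {x : ℕ → E} {l : E}
    (h : Tendsto (fun j => x (j + 1) - x j) atTop (𝓝 l)) :
    Tendsto (fun j : ℕ => (j : ℝ)⁻¹ • x j) atTop (𝓝 l) := by
  have h0 : Tendsto (fun j : ℕ => (j : ℝ)⁻¹ • x 0) atTop (𝓝 0) := by
    simpa using (tendsto_inv_atTop_nhds_zero_nat (𝕜 := ℝ)).smul_const (x 0)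
  have h1 := h.cesaro_smul.add h0
  rw [add_zero] at h1
  refine h1.congr fun j => ?_
  rw [Finset.sum_range_sub, ← smul_add, sub_add_cancel]

theorem tendsto_inv_natCast_smul_succ_of_tendsto_sub {x : ℕ → E} {l : E}
    (h : Tendsto (fun j => x (j + 1) - x j) atTop (𝓝 l)) :
    Tendsto (fun j : ℕ => (j : ℝ)⁻¹ • x (j + 1)) atTop (𝓝 l) := by
  have h1 := (tendsto_inv_natCast_smul_of_tendsto_sub h).add
    ((tendsto_inv_atTop_nhds_zero_nat (𝕜 := ℝ)).smul h)
  rw [zero_smul, add_zero] at h1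
  refine h1.congr fun j => ?_
  rw [← smul_add, add_sub_cancel]

theorem tendsto_inv_natCast_smul_of_norm_le {x : ℕ → E} {B : ℝ}
    (h : ∀ j, 1 ≤ j → ‖x j‖ ≤ B) :
    Tendsto (fun j : ℕ => (j : ℝ)⁻¹ • x j) atTop (𝓝 0) := by
  have hB : Tendsto (fun j : ℕ => (j : ℝ)⁻¹ * B) atTop (𝓝 0) := by
    simpa using (tendsto_inv_atTop_nhds_zero_nat (𝕜 := ℝ)).mul_const B
  refine squeeze_zero_norm' ?_ hB
  filter_upwards [eventually_ge_atTop 1] with j hj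
  rw [norm_smul, Real.norm_of_nonneg (by positivity)]
  gcongr
  exact h j hj

/-- A relaxed sequence grows at the same linear rate as the sequence it averages. -/
theorem tendsto_inv_natCast_smul_relaxation {x s : ℕ → E} {l : E} {ρ : ℝ}
    (hρ : ρ ∈ Set.Ioo (0 : ℝ) 2)
    (hs : ∀ j, 1 ≤ j → s (j + 1) = (1 - ρ) • s j + ρ • x (j + 1))
    (h : Tendsto (fun j => x (j + 1) - x j) atTop (𝓝 l)) :
    Tendsto (fun j : ℕ => (j : ℝ)⁻¹ • s j) atTop (𝓝 l) := by
  have hr : |1 - ρ| < 1 := by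
    rw [abs_lt]
    constructor <;> linarith [hρ.1, hρ.2]
  obtain ⟨B, hB⟩ := h.norm.bddAbove_range
  have hB' : ∀ j, ‖x (j + 1) - x j‖ ≤ B := fun j => hB ⟨j, rfl⟩
  set N := max ‖s 1 - x 1‖ (B / (1 - |1 - ρ|))
  have hBN : B ≤ N * (1 - |1 - ρ|) := by
    rw [← div_le_iff₀ (by linarith)]
    exact le_max_right _ _
  have hB0 : 0 ≤ B := (norm_nonneg _).trans (hB' 0)
  have hbound : ∀ j, 1 ≤ j → ‖s j - x j‖ ≤ N := by
    intro j hj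
    induction j, hj using Nat.le_induction with
    | base => exact le_max_left _ _
    | succ j hj ih =>
      have hstep : s (j + 1) - x (j + 1) = (1 - ρ) • ((s j - x j) - (x (j + 1) - x j)) := by
        rw [hs j hj]
        module
      rw [hstep, norm_smul, Real.norm_eq_abs]
      calc |1 - ρ| * ‖(s j - x j) - (x (j + 1) - x j)‖
          ≤ |1 - ρ| * (N + B) := by
            gcongr
            exact (norm_sub_le _ _).trans (add_le_add ih (hB' j))
        _ ≤ |1 - ρ| * N + B := by nlinarith
        _ ≤ N := by linarith
  have h1 := (tendsto_inv_natCast_smul_of_norm_le hbound).add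
    (tendsto_inv_natCast_smul_of_tendsto_sub h)
  rw [zero_add] at h1
  refine h1.congr fun j => ?_
  rw [← smul_add, sub_add_cancel]

end Growth

section MatrixAction

variable {ι κ : Type*} [Fintype ι] [Fintype κ] [DecidableEq κ]

theorem continuous_mvec (A : Matrix ι κ ℝ) : Continuous (mvec A) :=
  (Matrix.toEuclideanLin A).continuous_of_finiteDimensional

theorem inner_mvec_transpose [DecidableEq ι] (A : Matrix ι κ ℝ) (x : EuclideanSpace ℝ κ)
    (y : EuclideanSpace ℝ ι) : ⟪x, mvec Aᵀ y⟫ = ⟪y, mvec A x⟫ := by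
  rw [mvec, ← Matrix.conjTranspose_eq_transpose_of_trivial,
    Matrix.toEuclideanLin_conjTranspose_eq_adjoint, LinearMap.adjoint_inner_right,
    real_inner_comm]
  rfl

theorem inner_mvec_self (A : Matrix κ κ ℝ) (x : EuclideanSpace ℝ κ) :
    ⟪x, mvec A x⟫ = star x.ofLp ⬝ᵥ A *ᵥ x.ofLp := by
  rw [EuclideanSpace.inner_eq_star_dotProduct, dotProduct_comm]
  rfl

theorem mvec_eq_zero_of_inner_le_zero {P : Matrix κ κ ℝ} (hP : P.PosSemidef)
    {x : EuclideanSpace ℝ κ} (h : ⟪x, mvec P x⟫ ≤ 0) : mvec P x = 0 := by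
  have h0 : star x.ofLp ⬝ᵥ P *ᵥ x.ofLp = 0 :=
    le_antisymm (by rwa [← inner_mvec_self]) (hP.dotProduct_mulVec_nonneg _)
  have h1 := (hP.dotProduct_mulVec_zero_iff _).1 h0
  rw [mvec, Matrix.toLpLin_apply, h1, WithLp.toLp_zero]

end MatrixAction

/-- orthogonality relations `⟨z̄, Pz̄ + Hᵀw̄⟩ = 0`, `⟨w̄, Hz̄⟩ = 0`, and
consequently `Pz̄ = 0`, for the xPIPG limits. -/
theorem stmt15 {n m : ℕ} (P : Matrix (Fin n) (Fin n) ℝ) (q : EuclideanSpace ℝ (Fin n))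
    (H : Matrix (Fin m) (Fin n) ℝ) (g : EuclideanSpace ℝ (Fin m))
    (D : Set (EuclideanSpace ℝ (Fin n))) (K : Set (EuclideanSpace ℝ (Fin m)))
    (hP : P.PosSemidef)
    (hDne : D.Nonempty) (hDcl : IsClosed D) (hDcv : Convex ℝ D)
    (hKne : K.Nonempty) (hK : IsClosedConvexCone K)
    (α β ρ : ℝ) (hα : 0 < α) (hβ : 0 < β)
    (hstep : α * (specNorm P + β * specNorm H ^ 2) < 1)
    (hρ : ρ ∈ Set.Ioo (0 : ℝ) 2)
    (z ξ : ℕ → EuclideanSpace ℝ (Fin n)) (w η : ℕ → EuclideanSpace ℝ (Fin m))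
    (hz : ∀ j, 1 ≤ j → z (j + 1) = proj D (ξ j - α • (mvec P (ξ j) + q + mvec Hᵀ (η j))))
    (hw : ∀ j, 1 ≤ j → w (j + 1) =
      proj (polarCone K) (η j + β • (mvec H ((2 : ℝ) • z (j + 1) - ξ j) - g)))
    (hξ : ∀ j, 1 ≤ j → ξ (j + 1) = (1 - ρ) • ξ j + ρ • z (j + 1))
    (hη : ∀ j, 1 ≤ j → η (j + 1) = (1 - ρ) • η j + ρ • w (j + 1))
    (zbar : EuclideanSpace ℝ (Fin n)) (wbar : EuclideanSpace ℝ (Fin m))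
    (hzbar : Tendsto (fun j : ℕ => z (j + 1) - z j) atTop (𝓝 zbar))
    (hwbar : Tendsto (fun j : ℕ => w (j + 1) - w j) atTop (𝓝 wbar)) :
    ⟪zbar, mvec P zbar + mvec Hᵀ wbar⟫ = 0 ∧ ⟪wbar, mvec H zbar⟫ = 0 ∧
      mvec P zbar = 0 := by
  have hinv := tendsto_inv_atTop_nhds_zero_nat (𝕜 := ℝ)
  have hconst {k : ℕ} (v : EuclideanSpace ℝ (Fin k)) :
      Tendsto (fun j : ℕ => (j : ℝ)⁻¹ • v) atTop (𝓝 0) := by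
    simpa using hinv.smul_const v
  have hmap {k l : ℕ} (A : Matrix (Fin k) (Fin l) ℝ) {x : ℕ → EuclideanSpace ℝ (Fin l)}
      {a : EuclideanSpace ℝ (Fin l)} (hx : Tendsto (fun j : ℕ => (j : ℝ)⁻¹ • x j) atTop (𝓝 a)) :
      Tendsto (fun j : ℕ => (j : ℝ)⁻¹ • mvec A (x j)) atTop (𝓝 (mvec A a)) := by
    refine (((continuous_mvec A).tendsto a).comp hx).congr fun j => ?_
    exact map_smul (Matrix.toEuclideanLin A) _ _
  have hz' := tendsto_inv_natCast_smul_succ_of_tendsto_sub hzbar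
  have hw' := tendsto_inv_natCast_smul_succ_of_tendsto_sub hwbar
  have hξ' := tendsto_inv_natCast_smul_relaxation hρ hξ hzbar
  have hη' := tendsto_inv_natCast_smul_relaxation hρ hη hwbar
  have hHz : ⟪mvec H zbar, wbar⟫ = 0 := by
    have hx : Tendsto (fun j : ℕ => (j : ℝ)⁻¹ • ((2 : ℝ) • z (j + 1) - ξ j)) atTop
        (𝓝 zbar) := by
      have h := (hz'.const_smul (2 : ℝ)).sub hξ'
      rw [two_smul, add_sub_cancel_right] at h
      exact h.congr fun j => by module
    have hk : Tendsto (fun j : ℕ => (j : ℝ)⁻¹ •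
        (η j + β • (mvec H ((2 : ℝ) • z (j + 1) - ξ j) - g) - w (j + 1))) atTop
        (𝓝 (β • mvec H zbar)) := by
      have h := (hη'.add (((hmap H hx).sub (hconst g)).const_smul β)).sub hw'
      rw [sub_zero, add_sub_cancel_left] at h
      exact h.congr fun j => by module
    have hlim : ⟪β • mvec H zbar, wbar⟫ = 0 := by
      refine tendsto_nhds_unique_of_eventuallyEq (hk.inner hw') tendsto_const_nhds ?_
      filter_upwards [eventually_ge_atTop 1] with j hj
      rw [real_inner_smul_left, real_inner_smul_right, hw j hj, inner_sub_proj_polarCone,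
        mul_zero, mul_zero]
    rw [real_inner_smul_left] at hlim
    exact (mul_eq_zero.1 hlim).resolve_left hβ.ne'
  have hwHz : ⟪wbar, mvec H zbar⟫ = 0 := by rw [real_inner_comm, hHz]
  have hle : ⟪zbar, mvec P zbar + mvec Hᵀ wbar⟫ ≤ 0 := by
    obtain ⟨x, hxD⟩ := hDne
    have hn : Tendsto (fun j : ℕ => (j : ℝ)⁻¹ •
        (ξ j - α • (mvec P (ξ j) + q + mvec Hᵀ (η j)) - z (j + 1))) atTop
        (𝓝 (-(α • (mvec P zbar + mvec Hᵀ wbar)))) := by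
      have h := (hξ'.sub ((((hmap P hξ').add (hconst q)).add (hmap Hᵀ hη')).const_smul α)).sub hz'
      rw [add_zero, sub_sub_cancel_left] at h
      exact h.congr fun j => by module
    have hd : Tendsto (fun j : ℕ => (j : ℝ)⁻¹ • (x - z (j + 1))) atTop (𝓝 (-zbar)) := by
      have h := (hconst x).sub hz'
      rw [zero_sub] at h
      exact h.congr fun j => (smul_sub _ _ _).symm
    have hlim : ⟪-(α • (mvec P zbar + mvec Hᵀ wbar)), -zbar⟫ ≤ 0 := by
      refine le_of_tendsto (hn.inner hd) ?_
      filter_upwards [eventually_ge_atTop 1] with j hj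
      have h := (proj_mem_and_inner_le_zero ⟨x, hxD⟩ hDcl hDcv
        (ξ j - α • (mvec P (ξ j) + q + mvec Hᵀ (η j)))).2 x hxD
      rw [← hz j hj] at h
      rw [real_inner_smul_left, real_inner_smul_right]
      have hj0 : (0 : ℝ) ≤ (j : ℝ)⁻¹ := by positivity
      exact mul_nonpos_of_nonneg_of_nonpos hj0 (mul_nonpos_of_nonneg_of_nonpos hj0 h)
    rw [inner_neg_neg, real_inner_smul_left, real_inner_comm] at hlim
    exact nonpos_of_mul_nonpos_right hlim hα
  have hsplit : ⟪zbar, mvec P zbar + mvec Hᵀ wbar⟫ = ⟪zbar, mvec P zbar⟫ := by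
    rw [inner_add_right, inner_mvec_transpose, hwHz, add_zero]
  have hPz : mvec P zbar = 0 := mvec_eq_zero_of_inner_le_zero hP (hsplit ▸ hle)
  exact ⟨by rw [hsplit, hPz, inner_zero_right], hwHz, hPz⟩
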